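/- Assume K satisfies (K1) and f satisfies (f1) and (f2). Let α₁ ∈ G∪N and α₂>u₀, and assume u(·,α₂) attains the value u₀. If t(u₀,α₁) ≤ t(u₀,α₂) < ∞ and t(u₀,α₂)·|u'(t(u₀,α₂),α₂)| < t(u₀,α₁)·|u'(t(u₀,α₁),α₁)|, then for every s with u(R(α₂),α₂) < s < u₀ one has t(s,α₂) > t(s,α₁) and t(s,α₂)·|u'(t(s,α₂),α₂)| < t(s,α₁)·|u'(t(s,α₁),α₁)|. -/

import Mathlib

open Set Filter Topology MeasureTheory
open scoped ENNReal NNReal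

noncomputable section

/-- `φ_p(s) = |s|^{p-2} s` (with the convention `φ_p(0)=0`). -/
def phiP (p s : ℝ) : ℝ := |s| ^ (p - 2) * s

/-- `K` is strictly positive and `C¹` on `(0,∞)` and satisfies condition (K1):
the map `r ↦ p + r·K'(r)/K(r)` is strictly positive and decreasing on `(0,∞)`. -/
def CondK1 (p : ℝ) (K : ℝ → ℝ) : Prop :=
  (∀ r : ℝ, 0 < r → 0 < K r) ∧ ContDiffOn ℝ 1 K (Ioi 0) ∧
  (∀ r : ℝ, 0 < r → 0 < p + r * deriv K r / K r) ∧
  AntitoneOn (fun r => p + r * deriv K r / K r) (Ioi 0)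

/-- (f1): `f(0)=0`, `f>0` above `u₀`, `f≤0` and not identically `0` on `(0,u₀)`. -/
def CondF1 (f : ℝ → ℝ) (u₀ : ℝ) : Prop :=
  f 0 = 0 ∧ (∀ v : ℝ, u₀ < v → 0 < f v) ∧ (∀ v ∈ Ioo 0 u₀, f v ≤ 0) ∧
  ∃ v ∈ Ioo 0 u₀, f v ≠ 0

/-- (f2): `f` is continuous on `[0,∞)` and locally Lipschitz on `[u₀,∞)`. -/
def CondF2 (f : ℝ → ℝ) (u₀ : ℝ) : Prop :=
  ContinuousOn f (Ici 0) ∧ LocallyLipschitzOn (Ici u₀) f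

/-- `D`: the set of differentiability points of `f` within `[u₀,∞)`. -/
def Dset (f : ℝ → ℝ) (u₀ : ℝ) : Set ℝ :=
  {v | v ∈ Ici u₀ ∧ DifferentiableWithinAt ℝ f (Ici u₀) v}

/-- the (one-sided) derivative `f'` of `f` on `[u₀,∞)`. -/
def fder (f : ℝ → ℝ) (u₀ : ℝ) (v : ℝ) : ℝ := derivWithin f (Ici u₀) v

/-- (f3): `(p-1)f(u) ≤ f'(u)(u-u₀)` on `D`. -/
def CondF3 (p : ℝ) (f : ℝ → ℝ) (u₀ : ℝ) : Prop :=
  ∀ v ∈ Dset f u₀, (p - 1) * f v ≤ fder f u₀ v * (v - u₀)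

/-- (f4): `u ↦ u·f'(u)/f(u)` is decreasing on `D`. -/
def CondF4 (f : ℝ → ℝ) (u₀ : ℝ) : Prop :=
  AntitoneOn (fun v => v * fder f u₀ v / f v) (Dset f u₀)

/-- `u` is a solution of the radial equation
`(r^{n-1} φ_p(u'))' = -r^{n-1} K(r) f(u)` on the interval `I ⊆ [0,∞)`, `0 ∈ I`:
`u ∈ C¹(I)`, `r ↦ r^{n-1} φ_p(u'(r))` is `C¹` on `I` and the equation holds for `r ∈ I`, `r>0`. -/
def IsRadialSolution (p : ℝ) (n : ℕ) (K f : ℝ → ℝ) (I : Set ℝ) (u : ℝ → ℝ) : Prop :=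
  (0:ℝ) ∈ I ∧ I ⊆ Ici 0 ∧
  ContDiffOn ℝ 1 u I ∧
  ContDiffOn ℝ 1 (fun r => r ^ (n - 1) * phiP p (derivWithin u I r)) I ∧
  ∀ r ∈ I, 0 < r →
    HasDerivWithinAt (fun r => r ^ (n - 1) * phiP p (derivWithin u I r))
      (-(r ^ (n - 1) * K r * f (u r))) I r

/-- `F(s) = ∫₀^s f(t) dt`. -/
def Fint (f : ℝ → ℝ) (s : ℝ) : ℝ := ∫ t in (0:ℝ)..s, f t

/-- the derivative `u'` of a solution defined on `[0,∞)` (one-sided at `0`). -/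
def uderiv (u : ℝ → ℝ) : ℝ → ℝ := derivWithin u (Ici 0)

/-- `R(α) = sup {r>0 : u(t,α)>0 and u'(t,α)<0 for all t ∈ (0,r)}`,
as an extended nonnegative real (it may be `∞`). -/
def Rend (u : ℝ → ℝ) : ℝ≥0∞ :=
  sSup {R : ℝ≥0∞ | ∀ t : ℝ, 0 < t → ENNReal.ofReal t < R → 0 < u t ∧ uderiv u t < 0}

/-- the filter describing the approach `r → R⁻` to the right endpoint `R`
(`r → ∞` when `R = ∞`). -/
def endFilter (R : ℝ≥0∞) : Filter ℝ :=
  if R = ⊤ then atTop else 𝓝[<] R.toReal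

/-- `u : α ↦ u(·,α)` is the family of solutions of the initial value problems
(`u(0,α)=α`, `u'(0,α)=0`) for `α > u₀`, depending continuously on `(α,r)`
together with its derivative. -/
def IsFamily (p : ℝ) (n : ℕ) (K f : ℝ → ℝ) (u₀ : ℝ) (u : ℝ → ℝ → ℝ) : Prop :=
  (∀ α : ℝ, u₀ < α →
    IsRadialSolution p n K f (Ici 0) (u α) ∧ u α 0 = α ∧ uderiv (u α) 0 = 0) ∧
  ContinuousOn (fun q : ℝ × ℝ => u q.1 q.2) (Ioi u₀ ×ˢ Ici 0) ∧
  ContinuousOn (fun q : ℝ × ℝ => uderiv (u q.1) q.2) (Ioi u₀ ×ˢ Ici 0)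

/-- the set `N` of initial values of crossing solutions; here `uR α` denotes the
limiting value `u(R(α),α)`. -/
def Ncross (u : ℝ → ℝ → ℝ) (uR : ℝ → ℝ) (u₀ : ℝ) : Set ℝ :=
  {α | u₀ < α ∧ uR α = 0 ∧
    ∃ L : ℝ, L < 0 ∧ Tendsto (uderiv (u α)) (endFilter (Rend (u α))) (𝓝 L)}

/-- the set `G` of initial values of ground state solutions. -/
def Gset (u : ℝ → ℝ → ℝ) (uR : ℝ → ℝ) (u₀ : ℝ) : Set ℝ :=
  {α | u₀ < α ∧ uR α = 0 ∧
    Tendsto (uderiv (u α)) (endFilter (Rend (u α))) (𝓝 0)}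

/-- the set `P` of initial values of positive solutions. -/
def Pset (uR : ℝ → ℝ) (u₀ : ℝ) : Set ℝ := {α | u₀ < α ∧ 0 < uR α}

/-- `t(s,α)`: the first point at which the solution `u(·,α)` takes the value `s`
(the unique `r ∈ [0,R(α))` with `u(r,α)=s` when `s` is attained there). -/
def tInv (u : ℝ → ℝ) (s : ℝ) : ℝ := sInf {r : ℝ | 0 ≤ r ∧ u r = s}

lemma pos_and_uderiv_neg_of_lt_Rend {u : ℝ → ℝ} {r : ℝ} (h0 : 0 < r)
    (h : ENNReal.ofReal r < Rend u) : 0 < u r ∧ uderiv u r < 0 := by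
  obtain ⟨R, hR, hr⟩ := lt_sSup_iff.1 h
  exact hR r h0 hr

lemma isOpen_lt_Rend (u : ℝ → ℝ) :
    IsOpen {r : ℝ | 0 < r ∧ ENNReal.ofReal r < Rend u} :=
  (isOpen_lt continuous_const continuous_id).inter
    (isOpen_lt ENNReal.continuous_ofReal continuous_const)

instance endFilter_neBot (R : ℝ≥0∞) : (endFilter R).NeBot := by
  unfold endFilter
  split_ifs <;> infer_instance

lemma eventually_endFilter {R : ℝ≥0∞} (hR : 0 < R) :
    ∀ᶠ r in endFilter R, 0 < r ∧ ENNReal.ofReal r < R := by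
  unfold endFilter
  split_ifs with h
  · filter_upwards [eventually_gt_atTop 0] with r hr
    exact ⟨hr, by rw [h]; exact ENNReal.ofReal_lt_top⟩
  · filter_upwards [Ioo_mem_nhdsLT (ENNReal.toReal_pos hR.ne' h)] with r hr
    exact ⟨hr.1, (ENNReal.ofReal_lt_iff_lt_toReal hr.1.le h).2 hr.2⟩

lemma hasDerivAt_uderiv {u : ℝ → ℝ} (hu : ContDiffOn ℝ 1 u (Ici 0)) {r : ℝ} (hr : 0 < r) :
    HasDerivAt u (uderiv u r) r :=
  ((hu.differentiableOn one_ne_zero) r hr.le).hasDerivWithinAt.hasDerivAt (Ici_mem_nhds hr)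

lemma strictAntiOn_lt_Rend {u : ℝ → ℝ} (hu : ContDiffOn ℝ 1 u (Ici 0)) :
    StrictAntiOn u {r : ℝ | 0 ≤ r ∧ ENNReal.ofReal r < Rend u} := by
  intro x hx y hy hxy
  have : StrictAntiOn u (Icc 0 y) := by
    refine strictAntiOn_of_deriv_neg (convex_Icc 0 y) (hu.continuousOn.mono Icc_subset_Ici_self) ?_
    intro z hz
    rw [interior_Icc] at hz
    rw [(hasDerivAt_uderiv hu hz.1).deriv]
    exact (pos_and_uderiv_neg_of_lt_Rend hz.1
      ((ENNReal.ofReal_le_ofReal hz.2.le).trans_lt hy.2)).2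
  exact this ⟨hx.1, hxy.le⟩ ⟨hy.1, le_rfl⟩ hxy

lemma tInv_apply {u : ℝ → ℝ} (hu : ContDiffOn ℝ 1 u (Ici 0)) {r : ℝ} (h0 : 0 ≤ r)
    (hr : ENNReal.ofReal r < Rend u) : tInv u (u r) = r := by
  refine IsLeast.csInf_eq ⟨⟨h0, rfl⟩, fun x hx => ?_⟩
  by_contra! hlt
  have := strictAntiOn_lt_Rend hu
    ⟨hx.1, (ENNReal.ofReal_le_ofReal hlt.le).trans_lt hr⟩ ⟨h0, hr⟩ hlt
  exact this.ne' hx.2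

lemma tInv_spec {u : ℝ → ℝ} {l : ℝ} (hu : ContDiffOn ℝ 1 u (Ici 0)) (hR : 0 < Rend u)
    (hl : Tendsto u (endFilter (Rend u)) (𝓝 l)) {s : ℝ} (hs : s ∈ Ioo l (u 0)) :
    0 < tInv u s ∧ ENNReal.ofReal (tInv u s) < Rend u ∧ u (tInv u s) = s := by
  obtain ⟨b, hb, hbs⟩ :=
    ((eventually_endFilter hR).and (hl.eventually (gt_mem_nhds hs.1))).exists
  obtain ⟨r, hr, rfl⟩ := intermediate_value_Icc' hb.1.le
    (hu.continuousOn.mono Icc_subset_Ici_self) ⟨hbs.le, hs.2.le⟩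
  have hrR := (ENNReal.ofReal_le_ofReal hr.2).trans_lt hb.2
  rw [tInv_apply hu hr.1 hrR]
  refine ⟨hr.1.lt_of_ne ?_, hrR, rfl⟩
  rintro rfl
  exact lt_irrefl _ hs.2

lemma hasDerivAt_tInv {u : ℝ → ℝ} {l : ℝ} (hu : ContDiffOn ℝ 1 u (Ici 0)) (hR : 0 < Rend u)
    (hl : Tendsto u (endFilter (Rend u)) (𝓝 l)) {s : ℝ} (hs : s ∈ Ioo l (u 0)) :
    HasDerivAt (tInv u) (uderiv u (tInv u s))⁻¹ s := by
  have hspec := fun {x} => tInv_spec hu hR hl (s := x)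
  obtain ⟨h0, h1, h2⟩ := hspec hs
  have hd := hasDerivAt_uderiv hu h0
  refine HasDerivAt.of_local_left_inverse ?_ hd (pos_and_uderiv_neg_of_lt_Rend h0 h1).2.ne ?_
  · have hmono : StrictMonoOn (fun x => -tInv u x) (Ioo l (u 0)) := by
      intro x hx y hy hxy
      obtain ⟨hx0, hx1, hx2⟩ := hspec hx
      obtain ⟨hy0, hy1, hy2⟩ := hspec hy
      refine neg_lt_neg (((strictAntiOn_lt_Rend hu).lt_iff_gt ⟨hx0.le, hx1⟩ ⟨hy0.le, hy1⟩).1 ?_)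
      rwa [hx2, hy2]
    have hc : ContinuousAt (fun x => -tInv u x) s := by
      refine hmono.continuousAt_of_image_mem_nhds (Ioo_mem_nhds hs.1 hs.2) ?_
      have hev : ∀ᶠ r in 𝓝 (tInv u s), (0 < r ∧ ENNReal.ofReal r < Rend u) ∧
          u r ∈ Ioo l (u 0) :=
        ((isOpen_lt_Rend u).eventually_mem ⟨h0, h1⟩).and
          (hd.continuousAt.eventually_mem (by rw [h2]; exact Ioo_mem_nhds hs.1 hs.2))
      have hneg : Tendsto (fun x : ℝ => -x) (𝓝 (-tInv u s)) (𝓝 (tInv u s)) := by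
        simpa using (continuous_neg.tendsto (-tInv u s))
      filter_upwards [hneg.eventually hev] with r hr
      refine ⟨u (-r), hr.2, ?_⟩
      simp only [tInv_apply hu hr.1.1.le hr.1.2, neg_neg]
    exact hc.neg.congr (Eventually.of_forall fun x => neg_neg _)
  · filter_upwards [Ioo_mem_nhds hs.1 hs.2] with x hx using (hspec hx).2.2

/-- Derivative of `r ↦ r |u'(r)|` along a decreasing solution. -/
lemma hasDerivAt_mul_abs_uderiv {p : ℝ} {n : ℕ} {K f u : ℝ → ℝ} (hp : 1 < p) (hn : 1 ≤ n)
    (hu : IsRadialSolution p n K f (Ici 0) u) {r : ℝ} (h0 : 0 < r)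
    (h1 : ENNReal.ofReal r < Rend u) :
    HasDerivAt (fun x => x * |uderiv u x|)
      (((p - n) + r ^ p * K r * f (u r) * (r * |uderiv u r|) ^ (1 - p)) *
        |uderiv u r| / (p - 1)) r := by
  have hp1 : 0 < p - 1 := by linarith
  have hy : HasDerivAt (fun x => x ^ (n - 1) * phiP p (uderiv u x))
      (-(r ^ (n - 1) * K r * f (u r))) r :=
    (hu.2.2.2.2 r h0.le h0).hasDerivAt (Ici_mem_nhds h0)
  have hg : HasDerivAt (fun x => x ^ (p - n) * -(x ^ (n - 1) * phiP p (uderiv u x))) _ r :=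
    (Real.hasDerivAt_rpow_const (p := p - n) (Or.inl h0.ne')).mul hy.neg
  have hval : ∀ x, 0 < x → ENNReal.ofReal x < Rend u →
      x ^ (p - n) * -(x ^ (n - 1) * phiP p (uderiv u x)) = (x * |uderiv u x|) ^ (p - 1) := by
    intro x hx hxR
    have hneg := (pos_and_uderiv_neg_of_lt_Rend hx hxR).2
    have hv : 0 < |uderiv u x| := abs_pos.2 hneg.ne
    have he : uderiv u x = -|uderiv u x| := by rw [abs_of_neg hneg, neg_neg]
    have e1 : x ^ (n - 1) = x ^ ((n : ℝ) - 1) := by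
      rw [← Real.rpow_natCast, Nat.cast_sub hn, Nat.cast_one]
    have e2 : |uderiv u x| ^ (p - 1) = |uderiv u x| ^ (p - 2) * |uderiv u x| := by
      rw [← Real.rpow_add_one hv.ne']; ring_nf
    have e3 : x ^ (p - 1) = x ^ (p - n) * x ^ ((n : ℝ) - 1) := by
      rw [← Real.rpow_add hx]; ring_nf
    rw [Real.mul_rpow hx.le hv.le, e1, e2, e3, phiP]
    nth_rewrite 2 [he]
    ring
  have hr := hval r h0 h1
  have hv : 0 < |uderiv u r| := abs_pos.2 (pos_and_uderiv_neg_of_lt_Rend h0 h1).2.ne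
  have hW : 0 < r * |uderiv u r| := mul_pos h0 hv
  have hpow := hg.rpow_const (p := (p - 1)⁻¹) (Or.inl (by rw [hr]; positivity))
  have heq : (fun x => x * |uderiv u x|) =ᶠ[𝓝 r]
      fun x => (x ^ (p - n) * -(x ^ (n - 1) * phiP p (uderiv u x))) ^ (p - 1)⁻¹ := by
    filter_upwards [(isOpen_lt_Rend u).mem_nhds ⟨h0, h1⟩] with x hx
    rw [hval x hx.1 hx.2, Real.rpow_rpow_inv (mul_nonneg hx.1.le (abs_nonneg _)) hp1.ne']
  refine (hpow.congr_of_eventuallyEq heq).congr_deriv ?_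
  have e1 : r ^ (p - n - 1) = r ^ (p - n) / r := Real.rpow_sub_one h0.ne' _
  have e2 : r ^ (p - n) * r ^ (n - 1) = r ^ p / r := by
    rw [← Real.rpow_natCast, ← Real.rpow_add h0, Nat.cast_sub hn, ← Real.rpow_sub_one h0.ne']
    congr 1
    push_cast
    ring
  have e3 : ((r * |uderiv u r|) ^ (p - 1)) ^ ((p - 1)⁻¹ - 1) =
      r * |uderiv u r| * (r * |uderiv u r|) ^ (1 - p) := by
    rw [← Real.rpow_mul hW.le, mul_sub, mul_inv_cancel₀ hp1.ne', mul_one,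
      show 1 - (p - 1) = 1 + (1 - p) by ring, Real.rpow_add hW, Real.rpow_one]
  have e4 : (r * |uderiv u r|) ^ (p - 1) * (r * |uderiv u r|) ^ (1 - p) = 1 := by
    rw [← Real.rpow_add hW]
    simp
  rw [hr, e3, e1]
  have e5 : (p - n) * (r ^ (p - n) / r) * -(r ^ (n - 1) * phiP p (uderiv u r)) =
      (p - n) / r * (r * |uderiv u r|) ^ (p - 1) := by
    rw [← hr]
    ring
  have e6 : r ^ (p - n) * - -(r ^ (n - 1) * K r * f (u r)) = r ^ p / r * K r * f (u r) := by
    rw [← e2]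
    ring
  rw [e5, e6]
  generalize (r * |uderiv u r|) ^ (1 - p) = A at *
  generalize (r * |uderiv u r|) ^ (p - 1) = B at *
  field_simp
  linear_combination (p - n) * e4

lemma rpow_mul_monotoneOn {p : ℝ} {K : ℝ → ℝ} (hK : CondK1 p K) :
    MonotoneOn (fun r => r ^ p * K r) (Ioi 0) := by
  have hd : ∀ r : ℝ, 0 < r → HasDerivAt (fun r => r ^ p * K r)
      (p * r ^ (p - 1) * K r + r ^ p * deriv K r) r := fun r hr =>
    (Real.hasDerivAt_rpow_const (Or.inl hr.ne')).mul
      (((hK.2.1.differentiableOn one_ne_zero) r hr).differentiableAt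
        (Ioi_mem_nhds hr)).hasDerivAt
  refine monotoneOn_of_deriv_nonneg (convex_Ioi 0)
    (fun r hr => (hd r hr).continuousAt.continuousWithinAt)
    (fun r hr => (hd r (by simpa using hr)).differentiableAt.differentiableWithinAt) ?_
  intro r hr
  rw [interior_Ioi] at hr
  have hr0 : 0 < r := hr
  have hKr := hK.1 r hr
  rw [(hd r hr).deriv]
  have e : r ^ p = r ^ (p - 1) * r := by
    rw [← Real.rpow_add_one hr0.ne']; ring_nf
  have : p * r ^ (p - 1) * K r + r ^ p * deriv K r =
      r ^ (p - 1) * K r * (p + r * deriv K r / K r) := by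
    rw [e]; field_simp
  rw [this]
  have := hK.2.2.1 r hr
  positivity

/-- Backward comparison for the system `t' = -t / w`,
`(p-1) w' = (n-p) - t^p K(t) f(s) w^{1-p}`, abstracting `g(t) = t^p K(t)`. -/
lemma backward_comparison {p c a b : ℝ} (hp : 1 < p) {g f t₁ t₂ w₁ w₂ : ℝ → ℝ}
    (hab : a < b) (hg : MonotoneOn g (Ioi 0)) (hg0 : ∀ r, 0 < r → 0 < g r)
    (hf : ∀ s ∈ Ioo a b, f s ≤ 0)
    (ht₁ : ∀ s ∈ Icc a b, 0 < t₁ s) (ht₂ : ∀ s ∈ Icc a b, 0 < t₂ s)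
    (hw₁ : ∀ s ∈ Icc a b, 0 < w₁ s) (hw₂ : ∀ s ∈ Icc a b, 0 < w₂ s)
    (dt₁ : ∀ s ∈ Icc a b, HasDerivAt t₁ (-(t₁ s / w₁ s)) s)
    (dt₂ : ∀ s ∈ Icc a b, HasDerivAt t₂ (-(t₂ s / w₂ s)) s)
    (dw₁ : ∀ s ∈ Icc a b, HasDerivAt w₁ ((c - g (t₁ s) * f s * w₁ s ^ (1 - p)) / (p - 1)) s)
    (dw₂ : ∀ s ∈ Icc a b, HasDerivAt w₂ ((c - g (t₂ s) * f s * w₂ s ^ (1 - p)) / (p - 1)) s)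
    (hle : t₁ b ≤ t₂ b) (hlt : w₂ b < w₁ b) :
    t₁ a < t₂ a ∧ w₂ a < w₁ a := by
  have hp1 : 0 < p - 1 := by linarith
  have hlog : ∀ s ∈ Icc a b, HasDerivAt (fun s => Real.log (t₁ s) - Real.log (t₂ s))
      ((w₂ s)⁻¹ - (w₁ s)⁻¹) s := by
    intro s hs
    have h1 := ht₁ s hs
    have h2 := ht₂ s hs
    have h3 := hw₁ s hs
    have h4 := hw₂ s hs
    refine (((dt₁ s hs).log h1.ne').sub ((dt₂ s hs).log h2.ne')).congr_deriv ?_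
    field_simp
    ring
  have hcmp : ∀ x ∈ Ico a b, (∀ y ∈ Ioo x b, w₂ y < w₁ y) → t₁ x < t₂ x := by
    intro x hx hy
    have hm : StrictMonoOn (fun s => Real.log (t₁ s) - Real.log (t₂ s)) (Icc x b) := by
      refine strictMonoOn_of_deriv_pos (convex_Icc x b) (fun s hs =>
        (hlog s ⟨hx.1.trans hs.1, hs.2⟩).continuousAt.continuousWithinAt) ?_
      intro s hs
      rw [interior_Icc] at hs
      have hs' : s ∈ Icc a b := ⟨hx.1.trans hs.1.le, hs.2.le⟩
      rw [(hlog s hs').deriv]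
      exact sub_pos.2 (inv_strictAnti₀ (hw₂ s hs') (hy s hs))
    have h := hm (left_mem_Icc.2 hx.2.le) (right_mem_Icc.2 hx.2.le) hx.2
    have hb := Real.log_le_log (ht₁ b (right_mem_Icc.2 hab.le)) hle
    have hxI : x ∈ Icc a b := ⟨hx.1, hx.2.le⟩
    refine (Real.log_lt_log_iff (ht₁ x hxI) (ht₂ x hxI)).1 ?_
    simp only at h
    linarith
  have hall : ∀ x ∈ Icc a b, w₂ x < w₁ x := by
    by_contra! hcon
    have hcont : ContinuousOn (fun s => w₁ s - w₂ s) (Icc a b) := fun s hs =>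
      ((dw₁ s hs).sub (dw₂ s hs)).continuousAt.continuousWithinAt
    have hcl : IsCompact (Icc a b ∩ (fun s => w₁ s - w₂ s) ⁻¹' Iic 0) :=
      isCompact_Icc.of_isClosed_subset
        (hcont.preimage_isClosed_of_isClosed isClosed_Icc isClosed_Iic) inter_subset_left
    obtain ⟨y, hy, hyle⟩ := hcon
    obtain ⟨x, ⟨hx, hxle⟩, hmax⟩ := hcl.exists_isGreatest ⟨y, hy, sub_nonpos.2 hyle⟩
    replace hxle : w₁ x - w₂ x ≤ 0 := hxle
    have hxb : x < b := hx.2.lt_of_ne (by rintro rfl; linarith)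
    have hpos : ∀ z ∈ Ioo x b, w₂ z < w₁ z := by
      intro z hz
      by_contra! h
      exact hz.1.not_ge (hmax ⟨⟨hx.1.trans hz.1.le, hz.2.le⟩, sub_nonpos.2 h⟩)
    have hanti : AntitoneOn (fun s => w₁ s - w₂ s) (Icc x b) := by
      have hd : ∀ s ∈ Icc x b, HasDerivAt (fun s => w₁ s - w₂ s) _ s := fun s hs =>
        (dw₁ s ⟨hx.1.trans hs.1, hs.2⟩).sub (dw₂ s ⟨hx.1.trans hs.1, hs.2⟩)
      refine antitoneOn_of_deriv_nonpos (convex_Icc x b)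
        (hcont.mono (Icc_subset_Icc_left hx.1))
        (fun s hs => (hd s (interior_subset hs)).differentiableAt.differentiableWithinAt) ?_
      intro s hs
      rw [(hd s (interior_subset hs)).deriv]
      rw [interior_Icc] at hs
      have hsI : s ∈ Icc a b := ⟨hx.1.trans hs.1.le, hs.2.le⟩
      have htt := hcmp s ⟨hsI.1, hs.2⟩ fun z hz => hpos z ⟨hs.1.trans hz.1, hz.2⟩
      have hgg := hg (ht₁ s hsI) (ht₂ s hsI) htt.le
      have hww : w₁ s ^ (1 - p) ≤ w₂ s ^ (1 - p) :=
        Real.rpow_le_rpow_of_nonpos (hw₂ s hsI) (hpos s hs).le (by linarith)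
      have hmul : g (t₁ s) * w₁ s ^ (1 - p) ≤ g (t₂ s) * w₂ s ^ (1 - p) :=
        mul_le_mul hgg hww (Real.rpow_nonneg (hw₁ s hsI).le _) (hg0 _ (ht₂ s hsI)).le
      have := mul_le_mul_of_nonneg_left hmul (neg_nonneg.2 (hf s ⟨hx.1.trans_lt hs.1, hs.2⟩))
      rw [← sub_div]
      refine div_nonpos_of_nonpos_of_nonneg ?_ hp1.le
      linarith
    have := hanti (left_mem_Icc.2 hxb.le) (right_mem_Icc.2 hxb.le) hxb.le
    simp only at this
    linarith
  exact ⟨hcmp a ⟨le_rfl, hab⟩ fun y hy => hall y ⟨hy.1.le, hy.2.le⟩,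
    hall a (left_mem_Icc.2 hab.le)⟩

/-- The inverse of a decreasing solution, together with `w = t |u'(t)|`, solves a first-order
system in the variable `s`. -/
lemma hasDerivAt_tInv_system {p : ℝ} {n : ℕ} {K f u : ℝ → ℝ} {l s : ℝ} (hp : 1 < p) (hn : 1 ≤ n)
    (hu : IsRadialSolution p n K f (Ici 0) u) (hR : 0 < Rend u)
    (hl : Tendsto u (endFilter (Rend u)) (𝓝 l)) (hs : s ∈ Ioo l (u 0)) :
    0 < tInv u s ∧ 0 < tInv u s * |uderiv u (tInv u s)| ∧
    HasDerivAt (tInv u) (-(tInv u s / (tInv u s * |uderiv u (tInv u s)|))) s ∧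
    HasDerivAt (fun s => tInv u s * |uderiv u (tInv u s)|)
      (((n - p) - tInv u s ^ p * K (tInv u s) * f s *
        (tInv u s * |uderiv u (tInv u s)|) ^ (1 - p)) / (p - 1)) s := by
  obtain ⟨h0, h1, h2⟩ := tInv_spec hu.2.2.1 hR hl hs
  have hneg := (pos_and_uderiv_neg_of_lt_Rend h0 h1).2
  have hv : 0 < |uderiv u (tInv u s)| := abs_pos.2 hneg.ne
  have hp1 : p - 1 ≠ 0 := by linarith
  have ht := hasDerivAt_tInv hu.2.2.1 hR hl hs
  have he : (uderiv u (tInv u s))⁻¹ = -(|uderiv u (tInv u s)|)⁻¹ := by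
    rw [abs_of_neg hneg, inv_neg, neg_neg]
  rw [he] at ht
  refine ⟨h0, mul_pos h0 hv, ht.congr_deriv (by field_simp), ?_⟩
  refine ((hasDerivAt_mul_abs_uderiv hp hn hu h0 h1).comp s ht).congr_deriv ?_
  rw [h2]
  generalize (tInv u s * |uderiv u (tInv u s)|) ^ (1 - p) = A
  field_simp
  ring

/-- Proposition 3.1, second part: reverse comparison of solutions below `u₀`. -/
theorem comparison_below_u0_second
    (p : ℝ) (n : ℕ) (hp : 1 < p) (hn : p < n)
    (K f : ℝ → ℝ) (u₀ : ℝ) (hu₀ : 0 < u₀)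
    (hK : CondK1 p K) (hf1 : CondF1 f u₀) (hf2 : CondF2 f u₀)
    (u : ℝ → ℝ → ℝ) (hfam : IsFamily p n K f u₀ u)
    (uR : ℝ → ℝ)
    (huR : ∀ α : ℝ, u₀ < α → Tendsto (u α) (endFilter (Rend (u α))) (𝓝 (uR α)))
    (α₁ α₂ : ℝ) (hα₁ : α₁ ∈ Gset u uR u₀ ∪ Ncross u uR u₀) (hα₂ : u₀ < α₂)
    (hatt₁ : ∃ r : ℝ, 0 ≤ r ∧ ENNReal.ofReal r < Rend (u α₁) ∧ u α₁ r = u₀)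
    (hatt₂ : ∃ r : ℝ, 0 ≤ r ∧ ENNReal.ofReal r < Rend (u α₂) ∧ u α₂ r = u₀)
    (hle : tInv (u α₁) u₀ ≤ tInv (u α₂) u₀)
    (hlt : tInv (u α₂) u₀ * |uderiv (u α₂) (tInv (u α₂) u₀)| <
           tInv (u α₁) u₀ * |uderiv (u α₁) (tInv (u α₁) u₀)|) :
    ∀ s : ℝ, uR α₂ < s → s < u₀ →
      tInv (u α₁) s < tInv (u α₂) s ∧
      tInv (u α₂) s * |uderiv (u α₂) (tInv (u α₂) s)| <
        tInv (u α₁) s * |uderiv (u α₁) (tInv (u α₁) s)| := by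
  intro s hs hsu
  obtain ⟨hα₁0, huR₁⟩ : u₀ < α₁ ∧ uR α₁ = 0 := by
    rcases hα₁ with h | h <;> exact ⟨h.1, h.2.1⟩
  obtain ⟨hs₁, hi₁, -⟩ := hfam.1 α₁ hα₁0
  obtain ⟨hs₂, hi₂, -⟩ := hfam.1 α₂ hα₂
  have hR₁ : 0 < Rend (u α₁) := by
    obtain ⟨r, -, hr, -⟩ := hatt₁
    exact zero_le.trans_lt hr
  have hR₂ : 0 < Rend (u α₂) := by
    obtain ⟨r, -, hr, -⟩ := hatt₂
    exact zero_le.trans_lt hr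
  have hs0 : 0 < s := by
    refine lt_of_le_of_lt (ge_of_tendsto (huR α₂ hα₂) ?_) hs
    filter_upwards [eventually_endFilter hR₂] with r hr
    exact (pos_and_uderiv_neg_of_lt_Rend hr.1 hr.2).1.le
  have hn1 : 1 ≤ n := by
    have : (1 : ℝ) < n := hp.trans hn
    exact_mod_cast this.le
  have H₁ := fun x (hx : x ∈ Icc s u₀) => hasDerivAt_tInv_system hp hn1 hs₁ hR₁ (huR α₁ hα₁0)
    (s := x) ⟨by rw [huR₁]; exact hs0.trans_le hx.1, by rw [hi₁]; exact hx.2.trans_lt hα₁0⟩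
  have H₂ := fun x (hx : x ∈ Icc s u₀) => hasDerivAt_tInv_system hp hn1 hs₂ hR₂ (huR α₂ hα₂)
    (s := x) ⟨hs.trans_le hx.1, by rw [hi₂]; exact hx.2.trans_lt hα₂⟩
  exact backward_comparison (c := n - p) (g := fun r => r ^ p * K r) (f := f) hp hsu
    (rpow_mul_monotoneOn hK) (fun r hr => mul_pos (Real.rpow_pos_of_pos hr p) (hK.1 r hr))
    (fun x hx => hf1.2.2.1 x ⟨hs0.trans hx.1, hx.2⟩)
    (fun x hx => (H₁ x hx).1) (fun x hx => (H₂ x hx).1)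
    (fun x hx => (H₁ x hx).2.1) (fun x hx => (H₂ x hx).2.1)
    (fun x hx => (H₁ x hx).2.2.1) (fun x hx => (H₂ x hx).2.2.1)
    (fun x hx => (H₁ x hx).2.2.2) (fun x hx => (H₂ x hx).2.2.2) hle hlt
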